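/- arXiv:2501.17764 — 4 statements merged into one kernel-verified Lean document; each statement's English description precedes it below -/
import Mathlib

section
/- Let n ≥ 1, σ ∈ S_n and i ∈ {1,…,n}. Then e_{n−1}(l^n_i(σ)) = (i … n)⁻¹ · σ · (σ⁻¹(i) … n); in particular this product fixes n, and l^n_i((i … n)) is the identity of S_{n−1}. -/
/-- The cycle `(a … b)` inside the group of permutations of `ℕ` (1-indexed):
it sends `j` to `j + 1` for `a ≤ j < b`, sends `b` to `a`, and fixes every
other natural number. -/
def cyc (a b : ℕ) : Equiv.Perm ℕ :=
  ((List.range' a (b - a)).map fun j => Equiv.swap j (j + 1)).prod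

/-- Membership in `S_n ⊆ Perm ℕ` (1-indexed): `σ` fixes `0` and all `j > n`. -/
def memS (n : ℕ) (σ : Equiv.Perm ℕ) : Prop :=
  ∀ j : ℕ, j = 0 ∨ n < j → σ j = j

theorem cyc_apply {a b : ℕ} (h : a ≤ b) (j : ℕ) :
    cyc a b j = if a ≤ j ∧ j < b then j + 1 else if j = b then a else j := by
  obtain ⟨d, rfl⟩ := Nat.exists_eq_add_of_le h
  clear h
  induction d generalizing a with
  | zero => simp [cyc]; grind
  | succ d ih =>
    have hstep : cyc a (a + (d + 1)) = Equiv.swap a (a + 1) * cyc (a + 1) (a + 1 + d) := by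
      simp [cyc, List.range'_succ]
    rw [hstep, Equiv.Perm.mul_apply, ih, Equiv.swap_apply_def]
    grind

theorem cyc_inv_apply {a b : ℕ} (h : a ≤ b) (j : ℕ) :
    (cyc a b)⁻¹ j = if a < j ∧ j ≤ b then j - 1 else if j = a then b else j := by
  rw [Equiv.Perm.inv_eq_iff_eq, cyc_apply h]
  grind

theorem memS.inv {n : ℕ} {σ : Equiv.Perm ℕ} (hσ : memS n σ) : memS n σ⁻¹ := fun j hj =>
  Equiv.Perm.inv_eq_iff_eq.2 (hσ j hj).symm

theorem memS.apply_mem {n : ℕ} {σ : Equiv.Perm ℕ} (hσ : memS n σ) {j : ℕ}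
    (h1 : 1 ≤ j) (hn : j ≤ n) : 1 ≤ σ j ∧ σ j ≤ n := by
  by_contra hout
  have := σ.injective (hσ (σ j) (by omega))
  omega

/-- Fact: `e_{n-1}(l^n_i(σ)) = (i … n)⁻¹ σ (σ⁻¹(i) … n)`, where
`l^n_i(σ) = (r^n_i(σ⁻¹))⁻¹`.  Concretely, the permutation
`ρ := (i … n)⁻¹ σ (σ⁻¹(i) … n)` fixes `n` (so it lies in the image of the
embedding `e_{n-1} : S_{n-1} → S_n`, the embedding being the obvious inclusion
in `Perm ℕ`), and its inverse restricted to `{1,…,n-1}` is given by the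
defining piecewise formula for `r^n_i(σ⁻¹)` — that is, `ρ = e_{n-1}(l^n_i(σ))`.
In particular `l^n_i((i … n))` is the identity of `S_{n-1}`. -/
theorem l_eq_conjugation (n i : ℕ) (hn : 1 ≤ n) (hi1 : 1 ≤ i) (hin : i ≤ n)
    (σ : Equiv.Perm ℕ) (hσ : memS n σ) :
    (((cyc i n)⁻¹ * σ * cyc (σ⁻¹ i) n) n = n) ∧
    (∀ j : ℕ, 1 ≤ j → j ≤ n - 1 →
      ((cyc i n)⁻¹ * σ * cyc (σ⁻¹ i) n)⁻¹ j =
        if j ≤ i - 1 then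
          (if σ⁻¹ j ≤ σ⁻¹ i - 1 then σ⁻¹ j else σ⁻¹ j - 1)
        else
          (if σ⁻¹ (j + 1) ≤ σ⁻¹ i - 1 then σ⁻¹ (j + 1) else σ⁻¹ (j + 1) - 1)) ∧
    (σ = cyc i n → (cyc i n)⁻¹ * σ * cyc (σ⁻¹ i) n = 1) := by
  obtain ⟨hp1, hpn⟩ := hσ.inv.apply_mem hi1 hin
  refine ⟨?_, fun j hj1 hjn => ?_, ?_⟩
  · rw [Equiv.Perm.mul_apply, Equiv.Perm.mul_apply, cyc_apply hpn, cyc_inv_apply hin]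
    simp
  · have hne : ∀ k, k ≠ i → σ⁻¹ k ≠ σ⁻¹ i := fun k hk h => hk (σ⁻¹.injective h)
    have hle : ∀ k, 1 ≤ k → k ≤ n → σ⁻¹ k ≤ n := fun k h1 h2 => (hσ.inv.apply_mem h1 h2).2
    rw [mul_inv_rev, mul_inv_rev, inv_inv, Equiv.Perm.mul_apply, Equiv.Perm.mul_apply,
      cyc_apply hin, cyc_inv_apply hpn]
    grind
  · rintro rfl
    have hp : (cyc i n)⁻¹ i = n := by simp [cyc_inv_apply hin]
    rw [hp, inv_mul_cancel, one_mul]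
    simp [cyc]
end

section
/- Let k be a field of characteristic zero and S a wheelgebra. Define on S(1) the binary operation a ∗ b := t²_{2,1}(μ_{1,1}(a,b)). Then ∗ is associative, so (S(1), ∗) is a (nonunital) associative k-algebra; that is, every wheelgebra is admissible. -/
/-- `r^n_i(σ)`, realized inside `Perm ℕ` via the conjugation formula
`e_{n-1}(r^n_i(σ)) = (σ(i) … n)⁻¹ σ (i … n)` (for `σ ∈ S_n` this agrees with
the defining piecewise formula on `{1,…,n-1}` and fixes everything else). -/
def rP (n i : ℕ) (σ : Equiv.Perm ℕ) : Equiv.Perm ℕ :=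
  (cyc (σ i) n)⁻¹ * σ * cyc i n

/-- `l^n_i(σ) := (r^n_i(σ⁻¹))⁻¹`. -/
def lP (n i : ℕ) (σ : Equiv.Perm ℕ) : Equiv.Perm ℕ :=
  (rP n i σ⁻¹)⁻¹

/-- The block transposition `b_{a,b}(1 2) ∈ S_{a+b}` (1-indexed): it sends
`j ↦ j + b` for `1 ≤ j ≤ a`, `j ↦ j - a` for `a < j ≤ a + b`, and fixes
everything else. -/
def blockT (a b : ℕ) : Equiv.Perm ℕ := cyc 1 (a + b) ^ b

/-- The block-diagonal embedding `s_{n,m} : S_n × S_m → S_{n+m}`: `σ ∈ S_n`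
acts on `{1,…,n}` as itself and `σ' ∈ S_m` acts, shifted by `n`, on
`{n+1,…,n+m}`. -/
def sEmb (n m : ℕ) (σ σ' : Equiv.Perm ℕ) : Equiv.Perm ℕ :=
  σ * (blockT m n * σ' * (blockT m n)⁻¹)
/-- A diagonal `𝕊`-bimodule structure on the family of `k`-vector spaces `S`:
for each `n`, commuting `k`-linear left and right actions of `S_n` on `S n`,
the left action being `σ·v = L n σ v` and the right action `v·τ = R n τ v`
(only the values on permutations belonging to `S_n` are relevant). -/
def IsDiagAction (k : Type) [Field k] (S : ℕ → Type)
    [∀ n, AddCommGroup (S n)] [∀ n, Module k (S n)]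
    (L R : ∀ n, Equiv.Perm ℕ → S n →ₗ[k] S n) : Prop :=
  ∀ n : ℕ,
    (∀ v : S n, L n 1 v = v ∧ R n 1 v = v) ∧
    (∀ σ τ : Equiv.Perm ℕ, memS n σ → memS n τ → ∀ v : S n,
      L n (σ * τ) v = L n σ (L n τ v) ∧
      R n (σ * τ) v = R n τ (R n σ v) ∧
      L n σ (R n τ v) = R n τ (L n σ v))

/-- The family of contractions `t^{n+1}_{j,i} = t n j i : S (n+1) → S n`
(`1 ≤ i, j ≤ n+1`) makes the diagonal `𝕊`-bimodule `S` a wheelspace: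
axiom (W.1): `t^n_{j,i}(σ·v·τ) = l^n_j(σ) · t^n_{σ⁻¹(j),τ(i)}(v) · r^n_i(τ)`,
and axiom (W.2): `t^n_{j,i} ∘ t^{n+1}_{ℓ,k} = t^n_{j',i'} ∘ t^{n+1}_{ℓ',k'}`
where `(i',k') = (k-1,i)` if `i < k`, `(i',k') = (k,i+1)` if `k ≤ i`, and
`(j',ℓ')` is obtained from `(j,ℓ)` by the same rule. -/
def IsWheel (k : Type) [Field k] (S : ℕ → Type)
    [∀ n, AddCommGroup (S n)] [∀ n, Module k (S n)]
    (L R : ∀ n, Equiv.Perm ℕ → S n →ₗ[k] S n)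
    (t : ∀ n : ℕ, ℕ → ℕ → (S (n + 1) →ₗ[k] S n)) : Prop :=
  (∀ n i j : ℕ, 1 ≤ i → i ≤ n + 1 → 1 ≤ j → j ≤ n + 1 →
    ∀ σ τ : Equiv.Perm ℕ, memS (n + 1) σ → memS (n + 1) τ → ∀ v : S (n + 1),
      t n j i (L (n + 1) σ (R (n + 1) τ v)) =
        L n (lP (n + 1) j σ) (R n (rP (n + 1) i τ) (t n (σ⁻¹ j) (τ i) v))) ∧
  (∀ n i j a b : ℕ, 1 ≤ i → i ≤ n + 1 → 1 ≤ j → j ≤ n + 1 →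
    1 ≤ a → a ≤ n + 2 → 1 ≤ b → b ≤ n + 2 → ∀ v : S (n + 2),
      t n j i (t (n + 1) b a v) =
        t n (if j < b then b - 1 else b) (if i < a then a - 1 else a)
          (t (n + 1) (if j < b then j else j + 1) (if i < a then i else i + 1) v))
/-- `(S, mu, eta)` is a (unitary, associative) wheelgebra: the wheelspace `S`
carries `k`-bilinear products `μ_{n,m} = mu n m : S n × S m → S (n+m)` and a
unit `η = eta ∈ S 0` which are associative and unital, equivariant for the
block-diagonal embeddings `s_{n,m}`, and compatible with the contractions:
`t^{n+m}_{j,i}(μ_{n,m}(v,w)) = μ_{n-1,m}(t^n_{j,i}(v), w)` for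
`i, j ∈ {1,…,n}` and
`t^{n+m}_{j,i}(μ_{n,m}(v,w)) = μ_{n,m-1}(v, t^m_{j-n,i-n}(w))` for
`i, j ∈ {n+1,…,n+m}`. -/
def IsWheelgebra (k : Type) [Field k] (S : ℕ → Type)
    [∀ n, AddCommGroup (S n)] [∀ n, Module k (S n)]
    (L R : ∀ n, Equiv.Perm ℕ → S n →ₗ[k] S n)
    (t : ∀ n : ℕ, ℕ → ℕ → (S (n + 1) →ₗ[k] S n))
    (mu : ∀ n m : ℕ, S n →ₗ[k] S m →ₗ[k] S (n + m)) (eta : S 0) : Prop :=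
  IsDiagAction k S L R ∧ IsWheel k S L R t ∧
  (∀ (n m p : ℕ) (u : S n) (v : S m) (w : S p),
      mu (n + m) p (mu n m u v) w =
        cast (congrArg S (by omega : n + (m + p) = n + m + p))
          (mu n (m + p) u (mu m p v w))) ∧
  (∀ (n : ℕ) (v : S n),
      cast (congrArg S (by omega : 0 + n = n)) (mu 0 n eta v) = v ∧
      mu n 0 v eta = v) ∧
  (∀ (n m : ℕ) (σ τ σ' τ' : Equiv.Perm ℕ),
      memS n σ → memS n τ → memS m σ' → memS m τ' →
      ∀ (v : S n) (w : S m),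
        mu n m (L n σ (R n τ v)) (L m σ' (R m τ' w)) =
          L (n + m) (sEmb n m σ σ') (R (n + m) (sEmb n m τ τ') (mu n m v w))) ∧
  (∀ n m i j : ℕ, 1 ≤ i → i ≤ n + 1 → 1 ≤ j → j ≤ n + 1 →
      ∀ (v : S (n + 1)) (w : S m),
        t (n + m) j i
            (cast (congrArg S (by omega : n + 1 + m = n + m + 1))
              (mu (n + 1) m v w)) =
          mu n m (t n j i v) w) ∧
  (∀ n m i j : ℕ, n + 1 ≤ i → i ≤ n + m + 1 → n + 1 ≤ j → j ≤ n + m + 1 →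
      ∀ (v : S n) (w : S (m + 1)),
        t (n + m) j i
            (cast (congrArg S (by omega : n + (m + 1) = n + m + 1))
              (mu n (m + 1) v w)) =
          mu n m v (t m (j - n) (i - n) w))

/-- Every wheelgebra is admissible: the binary operation
`a ∗ b := t²_{2,1}(μ_{1,1}(a, b))` on `S 1` is associative, so `(S 1, ∗)` is a
(nonunital) associative `k`-algebra. -/
theorem wheelgebra_admissible (k : Type) [Field k] (S : ℕ → Type)
    [∀ n, AddCommGroup (S n)] [∀ n, Module k (S n)]
    (L R : ∀ n, Equiv.Perm ℕ → S n →ₗ[k] S n)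
    (t : ∀ n : ℕ, ℕ → ℕ → (S (n + 1) →ₗ[k] S n))
    (mu : ∀ n m : ℕ, S n →ₗ[k] S m →ₗ[k] S (n + m)) (eta : S 0)
    (h : IsWheelgebra k S L R t mu eta) :
    ∀ a b c : S 1,
      t 1 2 1 (mu 1 1 (t 1 2 1 (mu 1 1 a b)) c) =
        t 1 2 1 (mu 1 1 a (t 1 2 1 (mu 1 1 b c))) := by
  obtain ⟨-, ⟨-, contract_comm⟩, mul_assoc, -, -, contract_left, contract_right⟩ := h
  intro a b c
  have hl := contract_left 1 1 1 2 (by norm_num) (by norm_num) (by norm_num) (by norm_num)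
    (mu 1 1 a b) c
  have hr := contract_right 1 1 2 3 (by norm_num) (by norm_num) (by norm_num) (by norm_num)
    a (mu 1 1 b c)
  have hassoc := mul_assoc 1 1 1 a b c
  have hcomm := contract_comm 1 1 2 1 2 (by norm_num) (by norm_num) (by norm_num) (by norm_num)
    (by norm_num) (by norm_num) (by norm_num) (by norm_num) (mu 2 1 (mu 1 1 a b) c)
  simp only [cast_eq] at hl hr hassoc
  calc
    _ = t 1 2 1 (t 2 2 1 (mu 2 1 (mu 1 1 a b) c)) := congrArg (t 1 2 1) hl.symm
    _ = t 1 2 1 (t 2 3 2 (mu 2 1 (mu 1 1 a b) c)) := hcomm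
    _ = t 1 2 1 (t 2 3 2 (mu 1 2 a (mu 1 1 b c))) :=
      congrArg (fun v => t 1 2 1 (t 2 3 2 v)) hassoc
    _ = _ := congrArg (t 1 2 1) hr
end

section
/- Let k be a field of characteristic zero and S a commutative wheelgebra. With a ∗ b := t²_{2,1}(μ_{1,1}(a,b)) the associated associative product on S(1), one has t¹_{1,1}(a ∗ b) = t¹_{1,1}(b ∗ a) for all a, b ∈ S(1); that is, the contraction t¹_{1,1} : S(1) → S(0) vanishes on the commutator subspace [S(1), S(1)] of the algebra (S(1), ∗). -/
/-- The wheelgebra `(S, mu, eta)` is commutative: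
`μ_{n,m}(v, w) = b_{m,n}(1 2) · μ_{m,n}(w, v) · b_{n,m}(1 2)`. -/
def IsCommWheelgebra (k : Type) [Field k] (S : ℕ → Type)
    [∀ n, AddCommGroup (S n)] [∀ n, Module k (S n)]
    (L R : ∀ n, Equiv.Perm ℕ → S n →ₗ[k] S n)
    (t : ∀ n : ℕ, ℕ → ℕ → (S (n + 1) →ₗ[k] S n))
    (mu : ∀ n m : ℕ, S n →ₗ[k] S m →ₗ[k] S (n + m)) (eta : S 0) : Prop :=
  IsWheelgebra k S L R t mu eta ∧
  ∀ (n m : ℕ) (v : S n) (w : S m),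
    mu n m v w =
      cast (congrArg S (by omega : m + n = n + m))
        (L (m + n) (blockT m n) (R (m + n) (blockT n m) (mu m n w v)))

theorem cyc_one_two : cyc 1 2 = Equiv.swap 1 2 := by simp [cyc]

theorem cyc_self (n : ℕ) : cyc n n = 1 := by simp [cyc]

theorem blockT_one_one : blockT 1 1 = Equiv.swap 1 2 := by simp [blockT, cyc_one_two]

theorem rP_swap : rP 2 1 (Equiv.swap 1 2) = 1 := by
  simp [rP, cyc_one_two, cyc_self]

theorem lP_swap : lP 2 2 (Equiv.swap 1 2) = 1 := by
  simp [lP, rP, cyc_one_two, cyc_self]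

/-- For a commutative wheelgebra `S`, with `a ∗ b := t²_{2,1}(μ_{1,1}(a, b))`
the associated associative product on `S 1`, one has
`t¹_{1,1}(a ∗ b) = t¹_{1,1}(b ∗ a)` for all `a, b ∈ S 1`; i.e. the contraction
`t¹_{1,1} : S 1 → S 0` vanishes on the commutator subspace `[S 1, S 1]` of the
algebra `(S 1, ∗)`. -/
theorem contraction_vanishes_on_commutators (k : Type) [Field k]
    (S : ℕ → Type) [∀ n, AddCommGroup (S n)] [∀ n, Module k (S n)]
    (L R : ∀ n, Equiv.Perm ℕ → S n →ₗ[k] S n)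
    (t : ∀ n : ℕ, ℕ → ℕ → (S (n + 1) →ₗ[k] S n))
    (mu : ∀ n m : ℕ, S n →ₗ[k] S m →ₗ[k] S (n + m)) (eta : S 0)
    (h : IsCommWheelgebra k S L R t mu eta) :
    ∀ a b : S 1,
      t 0 1 1 (t 1 2 1 (mu 1 1 a b)) = t 0 1 1 (t 1 2 1 (mu 1 1 b a)) := by
  obtain ⟨⟨hact, ⟨hequiv, hcomm⟩, -⟩, hmu⟩ := h
  intro a b
  have hmem : memS 2 (Equiv.swap 1 2) := fun j hj =>
    Equiv.swap_apply_of_ne_of_ne (by omega) (by omega)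
  have hmu_swap : mu 1 1 b a =
      L 2 (Equiv.swap 1 2) (R 2 (Equiv.swap 1 2) (mu 1 1 a b)) := by
    simpa [blockT_one_one] using hmu 1 1 b a
  have hswap := hequiv 1 1 2 le_rfl (by omega) (by omega) le_rfl
    (Equiv.swap 1 2) (Equiv.swap 1 2) hmem hmem (mu 1 1 a b)
  simp only [Nat.reduceAdd, lP_swap, rP_swap, Equiv.swap_inv, Equiv.swap_apply_left,
    Equiv.swap_apply_right, ((hact 1).1 _).1, ((hact 1).1 _).2] at hswap
  rw [hmu_swap, hswap]
  simpa using hcomm 0 1 1 1 2 le_rfl le_rfl le_rfl le_rfl le_rfl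
    (by omega) (by omega) le_rfl (mu 1 1 a b)
end

section
/- Let k be a field of characteristic zero, S a wheelgebra, and N a wheelbimodule over S. Define on N(1) the operations a ▷ x := u²_{2,1}(ρ_{1,1,0}(a, x, η)) and x ◁ a := u²_{2,1}(ρ_{0,1,1}(η, x, a)), and on S(1) the product a ∗ b := t²_{2,1}(μ_{1,1}(a,b)). Then (a ∗ b) ▷ x = a ▷ (b ▷ x), x ◁ (a ∗ b) = (x ◁ a) ◁ b, and (a ▷ x) ◁ b = a ▷ (x ◁ b) for all a, b ∈ S(1) and x ∈ N(1); that is, N(1) is a bimodule over the associative algebra (S(1), ∗), so every wheelbimodule is admissible. -/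
/-- `(NN, u, rho)` is a wheelbimodule over the wheelgebra `(S, mu, eta)`:
`NN` is a wheelspace (with actions `Ln, Rn` and contractions `u`), with
`k`-multilinear actions `ρ_{n,m,p} = rho n m p : S n × NN m × S p → NN (n+m+p)`
which are equivariant for the block-diagonal embeddings
`S_n × S_m × S_p → S_{n+m+p}`, satisfy
`ρ_{n+m,p,q+r}(μ_{n,m}(a,b), x, μ_{q,r}(c,d)) = ρ_{n,m+p+q,r}(a, ρ_{m,p,q}(b,x,c), d)`
and `ρ_{0,n,0}(η, x, η) = x`, and are compatible with the contractions
slot-wise. -/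
def IsWheelBimod (k : Type) [Field k] (S : ℕ → Type)
    [∀ n, AddCommGroup (S n)] [∀ n, Module k (S n)]
    (L R : ∀ n, Equiv.Perm ℕ → S n →ₗ[k] S n)
    (t : ∀ n : ℕ, ℕ → ℕ → (S (n + 1) →ₗ[k] S n))
    (mu : ∀ n m : ℕ, S n →ₗ[k] S m →ₗ[k] S (n + m)) (eta : S 0)
    (NN : ℕ → Type) [∀ n, AddCommGroup (NN n)] [∀ n, Module k (NN n)]
    (Ln Rn : ∀ n, Equiv.Perm ℕ → NN n →ₗ[k] NN n)
    (u : ∀ n : ℕ, ℕ → ℕ → (NN (n + 1) →ₗ[k] NN n))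
    (rho : ∀ n m p : ℕ, S n →ₗ[k] NN m →ₗ[k] S p →ₗ[k] NN (n + m + p)) :
    Prop :=
  -- equivariance for the block-diagonal embeddings
  (∀ (n m p : ℕ) (σ₁ τ₁ σ₂ τ₂ σ₃ τ₃ : Equiv.Perm ℕ),
      memS n σ₁ → memS n τ₁ → memS m σ₂ → memS m τ₂ → memS p σ₃ → memS p τ₃ →
      ∀ (a : S n) (x : NN m) (c : S p),
        rho n m p (L n σ₁ (R n τ₁ a)) (Ln m σ₂ (Rn m τ₂ x))
            (L p σ₃ (R p τ₃ c)) =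
          Ln (n + m + p) (sEmb n (m + p) σ₁ (sEmb m p σ₂ σ₃))
            (Rn (n + m + p) (sEmb n (m + p) τ₁ (sEmb m p τ₂ τ₃))
              (rho n m p a x c))) ∧
  -- compatibility with the products of the wheelgebra
  (∀ (n m p q r : ℕ) (a : S n) (b : S m) (x : NN p) (c : S q) (d : S r),
      rho (n + m) p (q + r) (mu n m a b) x (mu q r c d) =
        cast (congrArg NN (by omega : n + (m + p + q) + r = n + m + p + (q + r)))
          (rho n (m + p + q) r a (rho m p q b x c) d)) ∧
  -- unitality
  (∀ (n : ℕ) (x : NN n),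
      cast (congrArg NN (by omega : 0 + n + 0 = n)) (rho 0 n 0 eta x eta) = x) ∧
  -- compatibility with contractions: indices in the first block
  (∀ n m p i j : ℕ, 1 ≤ i → i ≤ n + 1 → 1 ≤ j → j ≤ n + 1 →
      ∀ (a : S (n + 1)) (x : NN m) (c : S p),
        u (n + m + p) j i
            (cast (congrArg NN (by omega : n + 1 + m + p = n + m + p + 1))
              (rho (n + 1) m p a x c)) =
          rho n m p (t n j i a) x c) ∧
  -- indices in the middle block
  (∀ n m p i j : ℕ, n + 1 ≤ i → i ≤ n + m + 1 → n + 1 ≤ j → j ≤ n + m + 1 →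
      ∀ (a : S n) (x : NN (m + 1)) (c : S p),
        u (n + m + p) j i
            (cast (congrArg NN (by omega : n + (m + 1) + p = n + m + p + 1))
              (rho n (m + 1) p a x c)) =
          rho n m p a (u m (j - n) (i - n) x) c) ∧
  -- indices in the last block
  (∀ n m p i j : ℕ, n + m + 1 ≤ i → i ≤ n + m + p + 1 →
      n + m + 1 ≤ j → j ≤ n + m + p + 1 →
      ∀ (a : S n) (x : NN m) (c : S (p + 1)),
        u (n + m + p) j i
            (cast (congrArg NN (by omega : n + m + (p + 1) = n + m + p + 1))
              (rho n m (p + 1) a x c)) =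
          rho n m p a x (t p (j - n - m) (i - n - m) c))

/-- Every wheelbimodule is admissible: with
`a ▷ x := u²_{2,1}(ρ_{1,1,0}(a, x, η))`,
`x ◁ a := u²_{2,1}(ρ_{0,1,1}(η, x, a))` and
`a ∗ b := t²_{2,1}(μ_{1,1}(a, b))`, one has
`(a ∗ b) ▷ x = a ▷ (b ▷ x)`, `x ◁ (a ∗ b) = (x ◁ a) ◁ b` and
`(a ▷ x) ◁ b = a ▷ (x ◁ b)`, i.e. `NN 1` is a bimodule over the associative
algebra `(S 1, ∗)`. -/
theorem wheelbimodule_admissible (k : Type) [Field k] (S : ℕ → Type)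
    [∀ n, AddCommGroup (S n)] [∀ n, Module k (S n)]
    (L R : ∀ n, Equiv.Perm ℕ → S n →ₗ[k] S n)
    (t : ∀ n : ℕ, ℕ → ℕ → (S (n + 1) →ₗ[k] S n))
    (mu : ∀ n m : ℕ, S n →ₗ[k] S m →ₗ[k] S (n + m)) (eta : S 0)
    (NN : ℕ → Type) [∀ n, AddCommGroup (NN n)] [∀ n, Module k (NN n)]
    (Ln Rn : ∀ n, Equiv.Perm ℕ → NN n →ₗ[k] NN n)
    (u : ∀ n : ℕ, ℕ → ℕ → (NN (n + 1) →ₗ[k] NN n))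
    (rho : ∀ n m p : ℕ, S n →ₗ[k] NN m →ₗ[k] S p →ₗ[k] NN (n + m + p))
    (halg : IsWheelgebra k S L R t mu eta)
    (hact : IsDiagAction k NN Ln Rn) (hwheel : IsWheel k NN Ln Rn u)
    (hbimod : IsWheelBimod k S L R t mu eta NN Ln Rn u rho) :
    ∀ (a b : S 1) (x : NN 1),
      (u 1 2 1 (rho 1 1 0 (t 1 2 1 (mu 1 1 a b)) x eta) =
        u 1 2 1 (rho 1 1 0 a (u 1 2 1 (rho 1 1 0 b x eta)) eta)) ∧
      (u 1 2 1 (rho 0 1 1 eta x (t 1 2 1 (mu 1 1 a b))) =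
        u 1 2 1 (rho 0 1 1 eta (u 1 2 1 (rho 0 1 1 eta x a)) b)) ∧
      (u 1 2 1 (rho 0 1 1 eta (u 1 2 1 (rho 1 1 0 a x eta)) b) =
        u 1 2 1 (rho 1 1 0 a (u 1 2 1 (rho 0 1 1 eta x b)) eta)) := by
  obtain ⟨-, -, -, hunit, -, -, -⟩ := halg
  obtain ⟨-, hassoc, -, hfirst, hmid, hlast⟩ := hbimod
  intro a b x
  have hηη : mu 0 0 eta eta = eta := (hunit 0 eta).2
  have hη_mul (v : S 1) : mu 0 1 eta v = v := (hunit 1 v).1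
  have hmul_η (v : S 1) : mu 1 0 v eta = v := (hunit 1 v).2
  have hswap (y : NN 3) : u 1 2 1 (u 2 3 2 y) = u 1 2 1 (u 2 2 1 y) :=
    hwheel.2 1 1 2 2 3 (by simp) (by simp) (by simp) (by simp) (by simp) (by simp)
      (by simp) (by simp) y
  have hmid_left (y : NN 2) (c : S 1) :
      u 2 2 1 (rho 0 2 1 eta y c) = rho 0 1 1 eta (u 1 2 1 y) c :=
    hmid 0 1 1 1 2 (by simp) (by simp) (by simp) (by simp) eta y c
  have hmid_right (c : S 1) (y : NN 2) :
      u 2 3 2 (rho 1 2 0 c y eta) = rho 1 1 0 c (u 1 2 1 y) eta :=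
    hmid 1 1 0 2 3 (by simp) (by simp) (by simp) (by simp) c y eta
  refine ⟨?_, ?_, ?_⟩
  · have hcontract : u 2 2 1 (rho 2 1 0 (mu 1 1 a b) x eta) =
        rho 1 1 0 (t 1 2 1 (mu 1 1 a b)) x eta :=
      hfirst 1 1 0 1 2 (by simp) (by simp) (by simp) (by simp) (mu 1 1 a b) x eta
    have hact_mul : rho 2 1 0 (mu 1 1 a b) x (mu 0 0 eta eta) =
        rho 1 2 0 a (rho 1 1 0 b x eta) eta := hassoc 1 1 1 0 0 a b x eta eta
    rw [hηη] at hact_mul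
    rw [← hcontract, hact_mul, ← hmid_right, hswap]
  · have hcontract : u 2 3 2 (rho 0 1 2 eta x (mu 1 1 a b)) =
        rho 0 1 1 eta x (t 1 2 1 (mu 1 1 a b)) :=
      hlast 0 1 1 2 3 (by simp) (by simp) (by simp) (by simp) eta x (mu 1 1 a b)
    have hact_mul : rho 0 1 2 (mu 0 0 eta eta) x (mu 1 1 a b) =
        rho 0 2 1 eta (rho 0 1 1 eta x a) b := hassoc 0 0 1 1 1 eta eta x a b
    rw [hηη] at hact_mul
    rw [← hcontract, hact_mul, ← hmid_left, hswap]
  · have hright_outer : rho 1 1 1 (mu 0 1 eta a) x (mu 0 1 eta b) =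
        rho 0 2 1 eta (rho 1 1 0 a x eta) b := hassoc 0 1 1 0 1 eta a x eta b
    have hleft_outer : rho 1 1 1 (mu 1 0 a eta) x (mu 1 0 b eta) =
        rho 1 2 0 a (rho 0 1 1 eta x b) eta := hassoc 1 0 1 1 0 a eta x b eta
    rw [hη_mul, hη_mul] at hright_outer
    rw [hmul_η, hmul_η] at hleft_outer
    rw [← hmid_left, ← hmid_right, hswap, ← hright_outer, ← hleft_outer]
end
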